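/- arXiv:math/0510303 — 5 statements merged into one kernel-verified Lean document; each statement's English description precedes it below -/
import Mathlib

section
/- For ∨,0-semilattices S and T, every ∨,0-homomorphism f : S → T extends to a unique ∨,0-homomorphism R(f) : R(S) → R(T) such that R(f)(⋈(u,v,w)) = ⋈(f(u),f(v),f(w)) for all (u,v,w) ∈ C(S). -/
section ReducedConstruction

variable {S : Type*} [SemilatticeSup S] [OrderBot S]

/-- `x` is a reduced finite subset of `C(S) = {(u,v,w) : w ≤ u ⊔ v}`. -/
def IsReducedSet (x : Set (S × S × S)) : Prop :=
  x.Finite ∧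
  (∀ t ∈ x, t.2.2 ≤ t.1 ⊔ t.2.1) ∧
  (∃! u : S, (u, u, u) ∈ x) ∧
  (∀ u v w : S, (u, v, w) ∈ x → (v, u, w) ∈ x → u = v ∧ v = w) ∧
  (∀ p u v w : S, (p, p, p) ∈ x → (u, v, w) ∈ x → (u, v, w) ≠ (p, p, p) →
    ¬u ≤ p ∧ ¬v ≤ p ∧ ¬w ≤ p)

/-- `R(S)`: the set of all reduced subsets of `C(S)`. -/
def RSet (S : Type*) [SemilatticeSup S] [OrderBot S] := {x : Set (S × S × S) // IsReducedSet x}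

/-- `π(y)`: the coordinate of the unique diagonal triple of the reduced set `y`. -/
noncomputable def piR (y : RSet S) : S := y.2.2.2.1.exists.choose

/-- The partial order of `R(S)`. -/
def Rle (x y : RSet S) : Prop :=
  ∀ t ∈ x.1 \ y.1, t.1 ≤ piR y ∨ t.2.2 ≤ piR y

lemma isReduced_singleton (a : S) : IsReducedSet ({(a, a, a)} : Set (S × S × S)) := by
  refine ⟨Set.finite_singleton _, ?_, ⟨a, rfl, ?_⟩, ?_, ?_⟩
  · intro t ht
    rw [Set.mem_singleton_iff] at ht
    subst ht
    exact le_sup_left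
  · intro u hu
    rw [Set.mem_singleton_iff, Prod.mk.injEq, Prod.mk.injEq] at hu
    exact hu.1
  · intro u v w hu _
    rw [Set.mem_singleton_iff, Prod.mk.injEq, Prod.mk.injEq] at hu
    obtain ⟨h1, h2, h3⟩ := hu
    exact ⟨h1.trans h2.symm, h2.trans h3.symm⟩
  · intro p u v w hp hu hne
    rw [Set.mem_singleton_iff] at hp hu
    exact absurd (hu.trans hp.symm) hne

/-- The identification of `S` with a subset of `R(S)`, via `a ↦ {(a,a,a)}`. -/
def toRSet (a : S) : RSet S := ⟨{(a, a, a)}, isReduced_singleton a⟩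

lemma isReduced_pair {u v w : S} (h : w ≤ u ⊔ v)
    (h1 : ¬(u = v ∨ v = ⊥ ∨ w = ⊥)) (hu0 : u ≠ ⊥) :
    IsReducedSet ({((⊥ : S), (⊥ : S), (⊥ : S)), (u, v, w)} : Set (S × S × S)) := by
  push_neg at h1
  obtain ⟨huv, hv0, hw0⟩ := h1
  refine ⟨(Set.finite_singleton _).insert _, ?_, ⟨⊥, Set.mem_insert _ _, ?_⟩, ?_, ?_⟩
  · intro t ht
    simp only [Set.mem_insert_iff, Set.mem_singleton_iff] at ht
    rcases ht with rfl | rfl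
    · exact bot_le
    · exact h
  · intro q hq
    simp only [Set.mem_insert_iff, Set.mem_singleton_iff, Prod.mk.injEq] at hq
    rcases hq with ⟨hq1, _, _⟩ | ⟨hq1, hq2, _⟩
    · exact hq1
    · exact absurd (hq1.symm.trans hq2) huv
  · intro p q r hp hq
    simp only [Set.mem_insert_iff, Set.mem_singleton_iff, Prod.mk.injEq] at hp hq
    rcases hp with ⟨h1, h2, h3⟩ | ⟨h1, h2, h3⟩ <;> rcases hq with ⟨g1, g2, g3⟩ | ⟨g1, g2, g3⟩
    · exact ⟨h1.trans g1.symm, g1.trans h3.symm⟩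
    · exact absurd (g1.symm.trans h2) hu0
    · exact absurd (h1.symm.trans g2) hu0
    · exact absurd (h1.symm.trans g2) huv
  · intro p x y z hp ht hne
    simp only [Set.mem_insert_iff, Set.mem_singleton_iff, Prod.mk.injEq] at hp ht
    have hp0 : p = ⊥ := by
      rcases hp with ⟨e1, _, _⟩ | ⟨e1, e2, _⟩
      · exact e1
      · exact absurd (e1.symm.trans e2) huv
    subst hp0
    rcases ht with ⟨e1, e2, e3⟩ | ⟨e1, e2, e3⟩
    · exact absurd (by rw [e1, e2, e3]) hne
    · subst e1; subst e2; subst e3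
      exact ⟨fun hle => hu0 (le_bot_iff.1 hle), fun hle => hv0 (le_bot_iff.1 hle),
        fun hle => hw0 (le_bot_iff.1 hle)⟩

open Classical in
/-- The canonical generators `⋈(u,v,w)` of `R(S)`. -/
noncomputable def bowtie (u v w : S) : RSet S :=
  if h1 : u = v ∨ v = ⊥ ∨ w = ⊥ then toRSet w
  else if h2 : u = ⊥ then toRSet ⊥
  else if h : w ≤ u ⊔ v then
    ⟨{((⊥ : S), (⊥ : S), (⊥ : S)), (u, v, w)}, isReduced_pair h h1 h2⟩
  else toRSet w

end ReducedConstruction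

section Helpers

variable {S : Type*} [SemilatticeSup S] [OrderBot S]

lemma piR_mem (y : RSet S) : (piR y, piR y, piR y) ∈ y.1 := y.2.2.2.1.exists.choose_spec

lemma eq_piR {y : RSet S} {a : S} (h : (a, a, a) ∈ y.1) : a = piR y :=
  y.2.2.2.1.unique h (piR_mem y)

lemma piR_toRSet (a : S) : piR (toRSet a) = a := by
  have h := piR_mem (toRSet a)
  simpa [toRSet] using h

/-- The condition on a triple `t` and a reduced set `y` which, for `t` in `C(S)`, says that
`⋈ t ≤ y`. -/
def TripleBelow (t : S × S × S) (y : RSet S) : Prop :=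
  t ∈ y.1 ∨ t.1 ≤ piR y ∨ t.2.2 ≤ piR y

lemma rle_iff {x y : RSet S} : Rle x y ↔ ∀ t ∈ x.1, TripleBelow t y := by
  simp only [Rle, TripleBelow, Set.mem_sdiff, and_imp]
  exact forall₂_congr fun t _ => or_iff_not_imp_left.symm

lemma tripleBelow_diag {a : S} {y : RSet S} : TripleBelow (a, a, a) y ↔ a ≤ piR y := by
  simp only [TripleBelow, or_self]
  exact ⟨fun h => h.elim (fun h => (eq_piR h).le) id, Or.inr⟩

lemma le_piR_of_mem {u v w : S} {y : RSet S} (h : (u, v, w) ∈ y.1) (hv : v ≤ piR y) :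
    w ≤ piR y := by
  by_cases he : (u, v, w) = (piR y, piR y, piR y)
  · simp only [Prod.mk.injEq] at he
    exact he.2.2.le
  · exact absurd hv (y.2.2.2.2.2 _ _ _ _ (piR_mem y) h he).2.1

lemma TripleBelow.le_piR_of_middle {u v w : S} {y : RSet S} (h : TripleBelow (u, v, w) y)
    (hw : w ≤ u ⊔ v) (hv : v ≤ piR y) : w ≤ piR y := by
  rcases h with h | h | h
  · exact le_piR_of_mem h hv
  · exact hw.trans (sup_le h hv)
  · exact h

lemma TripleBelow.le_piR_of_swap {u v w : S} {y : RSet S} (h : TripleBelow (u, v, w) y)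
    (h' : TripleBelow (v, u, w) y) (hw : w ≤ u ⊔ v) : w ≤ piR y := by
  rcases h with h | h | h
  · rcases h' with h' | h' | h'
    · obtain ⟨rfl, rfl⟩ := y.2.2.2.2.1 _ _ _ h h'
      exact (eq_piR h).le
    · exact le_piR_of_mem h h'
    · exact h'
  · exact h'.le_piR_of_middle (hw.trans_eq (sup_comm _ _)) h
  · exact h

lemma tripleBelow_iff_of_degenerate {u v w : S} {y : RSet S} (hw : w ≤ u ⊔ v)
    (h : u = v ∨ v = ⊥ ∨ w = ⊥) : TripleBelow (u, v, w) y ↔ w ≤ piR y := by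
  refine ⟨fun hb => ?_, fun hb => Or.inr (Or.inr hb)⟩
  rcases h with rfl | rfl | rfl
  · exact hb.le_piR_of_swap hb hw
  · exact hb.le_piR_of_middle hw bot_le
  · exact bot_le

lemma forall_mem_bowtie_iff {T : Type*} [SemilatticeSup T] [OrderBot T] {f : S → T}
    (hf0 : f ⊥ = ⊥) (hfsup : ∀ a b : S, f (a ⊔ b) = f a ⊔ f b) {u v w : S} (hw : w ≤ u ⊔ v)
    {y : RSet T} :
    (∀ t ∈ (bowtie u v w).1, TripleBelow (f t.1, f t.2.1, f t.2.2) y) ↔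
      TripleBelow (f u, f v, f w) y := by
  have hfw : f w ≤ f u ⊔ f v := by
    rw [← hfsup, ← sup_eq_right, ← hfsup, sup_eq_right.2 hw]
  by_cases h1 : u = v ∨ v = ⊥ ∨ w = ⊥
  · have hval : bowtie u v w = toRSet w := dif_pos h1
    have h1' : f u = f v ∨ f v = ⊥ ∨ f w = ⊥ := by
      rcases h1 with rfl | rfl | rfl
      exacts [Or.inl rfl, Or.inr (Or.inl hf0), Or.inr (Or.inr hf0)]
    rw [tripleBelow_iff_of_degenerate hfw h1', hval]
    simp [toRSet, tripleBelow_diag]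
  by_cases h2 : u = ⊥
  · have hval : bowtie u v w = toRSet ⊥ := (dif_neg h1).trans (dif_pos h2)
    rw [hval, h2]
    simp [toRSet, hf0, TripleBelow]
  have hval : bowtie u v w = ⟨{(⊥, ⊥, ⊥), (u, v, w)}, isReduced_pair hw h1 h2⟩ :=
    (dif_neg h1).trans ((dif_neg h2).trans (dif_pos hw))
  rw [hval]
  simp [tripleBelow_diag, hf0]

lemma bowtie_le_iff [SemilatticeSup (RSet S)] (hS : ∀ x y : RSet S, x ≤ y ↔ Rle x y)
    {u v w : S} (hw : w ≤ u ⊔ v) {y : RSet S} :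
    bowtie u v w ≤ y ↔ TripleBelow (u, v, w) y := by
  rw [hS, rle_iff]
  exact forall_mem_bowtie_iff (f := id) rfl (fun _ _ => rfl) hw

/-- Saturation of a finite set `X` of triples together with the diagonal triple at `p`: there is a
reduced set above all of them whose image under `f` is below everything above their images. -/
lemma exists_saturation {T : Type*} [SemilatticeSup T] [OrderBot T] {f : S → T}
    (hfsup : ∀ a b : S, f (a ⊔ b) = f a ⊔ f b) (X : Finset (S × S × S))
    (hX : ∀ t ∈ X, t.2.2 ≤ t.1 ⊔ t.2.1) (p : S) :
    ∃ z : RSet S, p ≤ piR z ∧ (∀ t ∈ X, TripleBelow t z) ∧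
      ∀ y : RSet T, f p ≤ piR y → (∀ t ∈ X, TripleBelow (f t.1, f t.2.1, f t.2.2) y) →
        ∀ t ∈ z.1, TripleBelow (f t.1, f t.2.1, f t.2.2) y := by
  classical
  have hf : Monotone f := fun a b h => by
    rw [← sup_eq_right, ← hfsup, sup_eq_right.2 h]
  induction hn : X.card generalizing X p with
  | zero =>
    refine ⟨toRSet p, (piR_toRSet p).ge, by simp_all, fun y hy _ => ?_⟩
    simpa [toRSet, tripleBelow_diag] using hy
  | succ n ih =>
    have absorb : ∀ t ∈ X, ∀ q : S, p ≤ q → (t.1 ≤ q ∨ t.2.2 ≤ q) →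
        (∀ y : RSet T, f p ≤ piR y → (∀ t ∈ X, TripleBelow (f t.1, f t.2.1, f t.2.2) y) →
          f q ≤ piR y) →
        ∃ z : RSet S, p ≤ piR z ∧ (∀ t ∈ X, TripleBelow t z) ∧
          ∀ y : RSet T, f p ≤ piR y → (∀ t ∈ X, TripleBelow (f t.1, f t.2.1, f t.2.2) y) →
            ∀ t ∈ z.1, TripleBelow (f t.1, f t.2.1, f t.2.2) y := by
      intro t ht q hpq htq hq
      obtain ⟨z, hz, hXz, hzy⟩ := ih (X.erase t) (fun s hs => hX s (Finset.mem_of_mem_erase hs)) q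
        (by rw [Finset.card_erase_of_mem ht, hn, Nat.add_sub_cancel])
      refine ⟨z, hpq.trans hz, fun s hs => ?_, fun y hy hXy => hzy y (hq y hy hXy) fun s hs =>
        hXy s (Finset.mem_of_mem_erase hs)⟩
      by_cases hst : s = t
      · subst hst
        exact Or.inr (htq.imp (·.trans hz) (·.trans hz))
      · exact hXz s (Finset.mem_erase.2 ⟨hst, hs⟩)
    have hfX : ∀ t ∈ X, f t.2.2 ≤ f t.1 ⊔ f t.2.1 := fun t ht => by
      rw [← hfsup]
      exact hf (hX t ht)
    by_cases h1 : ∃ t ∈ X, t.1 ≤ p ∨ t.2.2 ≤ p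
    · obtain ⟨t, ht, htp⟩ := h1
      exact absorb t ht p le_rfl htp fun y hy _ => hy
    by_cases h2 : ∃ t ∈ X, t.2.1 ≤ p
    · obtain ⟨t, ht, htp⟩ := h2
      refine absorb t ht (p ⊔ t.2.2) le_sup_left (Or.inr le_sup_right) fun y hy hXy => ?_
      rw [hfsup]
      exact sup_le hy ((hXy t ht).le_piR_of_middle (hfX t ht) ((hf htp).trans hy))
    by_cases h3 : ∃ u v w, (u, v, w) ∈ X ∧ (v, u, w) ∈ X
    · obtain ⟨u, v, w, h, h'⟩ := h3
      refine absorb _ h (p ⊔ w) le_sup_left (Or.inr le_sup_right) fun y hy hXy => ?_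
      rw [hfsup]
      exact sup_le hy ((hXy _ h).le_piR_of_swap (hXy _ h') (hfX _ h))
    push Not at h1 h2 h3
    have hred : IsReducedSet (insert (p, p, p) (X : Set (S × S × S))) := by
      have hdiag : ∀ q, (q, q, q) ∈ insert (p, p, p) (X : Set (S × S × S)) → q = p := by
        rintro q (h | h)
        · exact (Prod.mk.inj h).1
        · exact absurd h (h3 q q q h)
      refine ⟨X.finite_toSet.insert _, ?_, ⟨p, Set.mem_insert _ _, hdiag⟩, ?_, ?_⟩
      · rintro t (rfl | h)
        exacts [le_sup_left, hX t h]
      · rintro u v w (h | h) (h' | h')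
        · grind
        · grind
        · grind
        · exact absurd h' (h3 u v w h)
      · rintro q u v w hq (h | h) hne
        · exact absurd (h.trans (by rw [hdiag q hq])) hne
        · rw [hdiag q hq]
          exact ⟨(h1 _ h).1, h2 _ h, (h1 _ h).2⟩
    refine ⟨⟨_, hred⟩, (eq_piR (y := ⟨_, hred⟩) (Set.mem_insert _ _)).le,
      fun t ht => Or.inl (Set.mem_insert_of_mem _ ht), fun y hy hXy t ht => ?_⟩
    rcases ht with rfl | ht
    exacts [tripleBelow_diag.2 hy, hXy t ht]

end Helpers

/-- every `∨,0`-homomorphism `f : S → T` extends to a unique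
`∨,0`-homomorphism `R(f) : R(S) → R(T)` with `R(f)(⋈(u,v,w)) = ⋈(f u, f v, f w)`
for all `(u,v,w) ∈ C(S)`. -/
theorem RSet_map_exists_unique (S T : Type*) [SemilatticeSup S] [OrderBot S]
    [SemilatticeSup T] [OrderBot T]
    [instS : SemilatticeSup (RSet S)] [instBS : OrderBot (RSet S)]
    [instT : SemilatticeSup (RSet T)] [instBT : OrderBot (RSet T)]
    (hS : ∀ x y : RSet S, x ≤ y ↔ Rle x y) (hT : ∀ x y : RSet T, x ≤ y ↔ Rle x y)
    (f : S → T) (hf0 : f ⊥ = ⊥) (hfsup : ∀ a b : S, f (a ⊔ b) = f a ⊔ f b) :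
    ∃! g : RSet S → RSet T,
      g ⊥ = ⊥ ∧ (∀ x y : RSet S, g (x ⊔ y) = g x ⊔ g y) ∧
      (∀ a : S, g (toRSet a) = toRSet (f a)) ∧
      (∀ u v w : S, w ≤ u ⊔ v → g (bowtie u v w) = bowtie (f u) (f v) (f w)) := by
  classical
  have hf : Monotone f := fun a b h => by
    rw [← sup_eq_right, ← hfsup, sup_eq_right.2 h]
  have hfC : ∀ (x : RSet S), ∀ t ∈ x.1, f t.2.2 ≤ f t.1 ⊔ f t.2.1 := fun x t ht => by
    rw [← hfsup]
    exact hf (x.2.2.1 t ht)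
  let g : RSet S → RSet T := fun x =>
    x.2.1.toFinset.sup fun t => bowtie (f t.1) (f t.2.1) (f t.2.2)
  have hg : ∀ x y, g x ≤ y ↔ ∀ t ∈ x.1, TripleBelow (f t.1, f t.2.1, f t.2.2) y := by
    intro x y
    simp only [g, Finset.sup_le_iff, Set.Finite.mem_toFinset]
    exact forall₂_congr fun t ht => bowtie_le_iff hT (hfC x t ht)
  have hgmono : Monotone g := by
    intro x y hxy
    rw [hg]
    intro t ht
    have hy := (hg y _).1 le_rfl
    have hπ := tripleBelow_diag.1 (hy _ (piR_mem y))
    rcases rle_iff.1 ((hS x y).1 hxy) t ht with h | h | h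
    · exact hy t h
    · exact Or.inr (Or.inl ((hf h).trans hπ))
    · exact Or.inr (Or.inr ((hf h).trans hπ))
  have hgsup : ∀ x y, g (x ⊔ y) = g x ⊔ g y := by
    intro x y
    refine le_antisymm ?_ (hgmono.le_map_sup x y)
    obtain ⟨z, -, hXz, hz⟩ := exists_saturation hfsup (x.2.1.toFinset ∪ y.2.1.toFinset)
      (by
        intro t ht
        rcases Finset.mem_union.1 ht with h | h
        exacts [x.2.2.1 t (by simpa using h), y.2.2.1 t (by simpa using h)]) ⊥
    have hxz : x ≤ z := (hS _ _).2 (rle_iff.2 fun t ht => hXz t (by simp [ht]))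
    have hyz : y ≤ z := (hS _ _).2 (rle_iff.2 fun t ht => hXz t (by simp [ht]))
    refine (hgmono (sup_le hxz hyz)).trans ((hg _ _).2 (hz _ (by rw [hf0]; exact bot_le) ?_))
    intro t ht
    rcases Finset.mem_union.1 ht with h | h
    · exact (hg x _).1 le_sup_left t (by simpa using h)
    · exact (hg y _).1 le_sup_right t (by simpa using h)
  have hbot : (⊥ : RSet S) = toRSet ⊥ := by
    refine (eq_bot_iff.2 ((hS _ _).2 (rle_iff.2 ?_))).symm
    simp [toRSet, tripleBelow_diag]
  refine ⟨g, ⟨?_, hgsup, fun a => ?_, fun u v w hw => ?_⟩, ?_⟩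
  · refine le_bot_iff.1 ((hg _ _).2 ?_)
    simp [hbot, toRSet, tripleBelow_diag, hf0]
  · refine eq_of_forall_ge_iff fun y => ?_
    rw [hg, hT, rle_iff]
    simp [toRSet]
  · refine eq_of_forall_ge_iff fun y => ?_
    rw [hg, bowtie_le_iff hT (by rw [← hfsup]; exact hf hw), forall_mem_bowtie_iff hf0 hfsup hw]
  · rintro k ⟨hk0, hksup, -, hkb⟩
    funext x
    have hx : x = x.2.1.toFinset.sup fun t => bowtie t.1 t.2.1 t.2.2 := by
      refine eq_of_forall_ge_iff fun y => ?_
      rw [hS, rle_iff, Finset.sup_le_iff]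
      simp only [Set.Finite.mem_toFinset]
      exact forall₂_congr fun t ht => (bowtie_le_iff hS (x.2.2.1 t ht)).symm
    calc k x = k (x.2.1.toFinset.sup fun t => bowtie t.1 t.2.1 t.2.2) := congrArg k hx
      _ = x.2.1.toFinset.sup (k ∘ fun t => bowtie t.1 t.2.1 t.2.2) :=
        Finset.apply_sup_eq_sup_comp k hksup hk0
      _ = g x := Finset.sup_congr rfl fun t ht => hkb _ _ _ (x.2.2.1 t (by simpa using ht))
end

section
/- Let Λ be a chain and let X, Y be well-ordered subsets of Λ such that otp(X) ≤ otp(Y) and X ∩ Y is a lower subset of both X and Y. Then x[Y/X] = x for all x ∈ F(X ∩ Y). -/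
section Tower

variable {D : Type*} [SemilatticeSup D] [OrderBot D]

/-- `x` is a reduced finite subset of `C(A)`, for a subset `A` of the ambient
`∨,0`-semilattice `D`. -/
def IsReducedIn (A : Set D) (x : Set (D × D × D)) : Prop :=
  x.Finite ∧
  (∀ t ∈ x, t.1 ∈ A ∧ t.2.1 ∈ A ∧ t.2.2 ∈ A ∧ t.2.2 ≤ t.1 ⊔ t.2.1) ∧
  (∃! u : D, (u, u, u) ∈ x) ∧
  (∀ u v w : D, (u, v, w) ∈ x → (v, u, w) ∈ x → u = v ∧ v = w) ∧
  (∀ p u v w : D, (p, p, p) ∈ x → (u, v, w) ∈ x → (u, v, w) ≠ (p, p, p) →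
    ¬u ≤ p ∧ ¬v ≤ p ∧ ¬w ≤ p)

/-- The coordinate of the (unique, for a reduced set) diagonal triple of `x`. -/
noncomputable def piIn (x : Set (D × D × D)) : D := by
  classical exact if h : ∃ u : D, (u, u, u) ∈ x then h.choose else ⊥

/-- The partial order between reduced sets. -/
def RleIn (x y : Set (D × D × D)) : Prop :=
  ∀ t ∈ x \ y, t.1 ≤ piIn y ∨ t.2.2 ≤ piIn y

/-- A realization, inside an ambient `∨,0`-semilattice `D`, of the increasing chain
`S0 = R⁰(S0) ⊆ R¹(S0) ⊆ R²(S0) ⊆ …` of iterated free distributive extensions whose union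
`D(S0)` is all of `D` : `T n` realizes `Rⁿ(S0)`, and `φ n` is the canonical bijection from
the set of reduced subsets of `C(T n)` onto `T (n+1)`, which is an order-isomorphism
fixing `T n` (identified with the diagonal singletons). -/
structure RTower (D : Type*) [SemilatticeSup D] [OrderBot D] (S0 : Set D) where
  T : ℕ → Set D
  φ : (n : ℕ) → {x : Set (D × D × D) // IsReducedIn (T n) x} → D
  T_zero : T 0 = S0
  bot_mem : ∀ n, (⊥ : D) ∈ T n
  sup_mem : ∀ n, ∀ x ∈ T n, ∀ y ∈ T n, x ⊔ y ∈ T n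
  phi_range : ∀ n, Set.range (φ n) = T (n + 1)
  phi_inj : ∀ n, Function.Injective (φ n)
  phi_diag : ∀ (n : ℕ) (x : {x : Set (D × D × D) // IsReducedIn (T n) x}) (a : D),
    x.1 = {(a, a, a)} → φ n x = a
  phi_le : ∀ (n : ℕ) (x y : {x : Set (D × D × D) // IsReducedIn (T n) x}),
    φ n x ≤ φ n y ↔ RleIn x.1 y.1
  union_univ : (⋃ n, T n) = (Set.univ : Set D)

/-- The realization, inside `D`, of the `n`-th level `Rⁿ(B)` of the free distributive
extension of a `∨,0`-subsemilattice `B ⊆ S0`. -/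
def RTower.FXn {S0 : Set D} (tw : RTower D S0) (B : Set D) : ℕ → Set D
  | 0 => B
  | n + 1 => {d | ∃ x : {x : Set (D × D × D) // IsReducedIn (tw.T n) x},
      tw.φ n x = d ∧ ∀ t ∈ x.1, t.1 ∈ tw.FXn B n ∧ t.2.1 ∈ tw.FXn B n ∧ t.2.2 ∈ tw.FXn B n}

/-- The realization, inside `D`, of the free distributive extension `D(B)` of a
`∨,0`-subsemilattice `B ⊆ S0`. -/
def RTower.FX {S0 : Set D} (tw : RTower D S0) (B : Set D) : Set D := ⋃ n, tw.FXn B n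

end Tower
section SLam

/-- A realization, inside an ambient `∨,0`-semilattice `D`, of the `∨,0`-semilattice `S(Λ)`
presented by generators `a`, `b`, `cᵢ` (for `i ∈ Λ`) and relations `cᵢ ≤ a ⊔ b` and
`cᵢ ≤ c j` for `i ≤ j`: the listed conditions say exactly that the `∨,0`-subsemilattice
generated by `a`, `b` and the `cᵢ` is freely presented by those relations. -/
structure SLamData (D : Type*) [SemilatticeSup D] [OrderBot D]
    (Λ : Type*) [LinearOrder Λ] where
  a : D
  b : D
  c : Λ → D
  c_mono : Monotone c
  c_le_ab : ∀ i, c i ≤ a ⊔ b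
  not_a_le : ∀ i, ¬ a ≤ b ⊔ c i
  not_b_le : ∀ i, ¬ b ≤ a ⊔ c i
  not_a_le_b : ¬ a ≤ b
  not_b_le_a : ¬ b ≤ a
  not_c_le_a : ∀ i, ¬ c i ≤ a
  not_c_le_b : ∀ i, ¬ c i ≤ b
  c_le_a_sup_c : ∀ i j, c i ≤ a ⊔ c j → i ≤ j
  c_le_b_sup_c : ∀ i j, c i ≤ b ⊔ c j → i ≤ j

/-- The `∨,0`-subsemilattice `S(X)` of `S(Λ)` generated by `{0, a, b, a ⊔ b} ∪ {cᵢ : i ∈ X}`,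
realized inside the ambient semilattice `D`. -/
def SLamData.SX {D : Type*} [SemilatticeSup D] [OrderBot D] {Λ : Type*} [LinearOrder Λ]
    (sd : SLamData D Λ) (X : Set Λ) : Set D :=
  supClosure ({⊥, sd.a, sd.b, sd.a ⊔ sd.b} ∪ sd.c '' X)

end SLam

/-- The coordinatewise action of a map `ψ : D → D` on triples. -/
def tripleMap {D : Type*} (ψ : D → D) (t : D × D × D) : D × D × D :=
  (ψ t.1, ψ t.2.1, ψ t.2.2)

/-- `ψ : D → D` realizes (on `F(X) ⊆ D = F(Λ)`) the `∨,0`-homomorphism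
`F(f) : F(X) → F(Λ)` induced by an isotone map `f` defined on `X`: it fixes `a`, `b`, `0`,
sends `cᵢ` to `c_{f i}` for `i ∈ X`, preserves joins, and commutes with the canonical
bijections `φ n` levelwise. -/
def IsFHomOn {D : Type*} [SemilatticeSup D] [OrderBot D] {Λ : Type*} [LinearOrder Λ]
    (sd : SLamData D Λ) (tw : RTower D (sd.SX Set.univ)) (X : Set Λ) (f : Λ → Λ)
    (ψ : D → D) : Prop :=
  ψ ⊥ = ⊥ ∧ ψ sd.a = sd.a ∧ ψ sd.b = sd.b ∧
  (∀ i ∈ X, ψ (sd.c i) = sd.c (f i)) ∧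
  (∀ x y : D, x ∈ tw.FX (sd.SX X) → y ∈ tw.FX (sd.SX X) → ψ (x ⊔ y) = ψ x ⊔ ψ y) ∧
  ∀ (n : ℕ) (x y : {x : Set (D × D × D) // IsReducedIn (tw.T n) x}),
    (∀ t ∈ x.1, t.1 ∈ tw.FXn (sd.SX X) n ∧ t.2.1 ∈ tw.FXn (sd.SX X) n ∧
      t.2.2 ∈ tw.FXn (sd.SX X) n) →
    y.1 = tripleMap ψ '' x.1 → ψ (tw.φ n x) = tw.φ n y

theorem SLamData.SX_mono {D : Type*} [SemilatticeSup D] [OrderBot D] {Λ : Type*}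
    [LinearOrder Λ] (sd : SLamData D Λ) {X Y : Set Λ} (h : X ⊆ Y) : sd.SX X ⊆ sd.SX Y :=
  supClosure_mono (Set.union_subset_union_right _ (Set.image_mono h))

theorem RTower.FXn_mono {D : Type*} [SemilatticeSup D] [OrderBot D] {S0 : Set D}
    (tw : RTower D S0) {A B : Set D} (h : A ⊆ B) (n : ℕ) : tw.FXn A n ⊆ tw.FXn B n := by
  induction n with
  | zero => exact h
  | succ n ih =>
    rintro d ⟨x, hx, ht⟩
    exact ⟨x, hx, fun t htx => ⟨ih (ht t htx).1, ih (ht t htx).2.1, ih (ht t htx).2.2⟩⟩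

/-- An order-embedding of `X` onto a lower subset of `Y` fixes every point of `X ∩ Y`, when
`X ∩ Y` is a lower subset of both `X` and `Y`. -/
theorem StrictMonoOn.eq_self_of_mem_inter {Λ : Type*} [LinearOrder Λ] {X Y : Set Λ}
    {f : Λ → Λ} (hsm : StrictMonoOn f X) (hX : X.IsWF)
    (hlowX : ∀ p ∈ X, ∀ q ∈ X ∩ Y, p ≤ q → p ∈ X ∩ Y)
    (hlowY : ∀ p ∈ Y, ∀ q ∈ X ∩ Y, p ≤ q → p ∈ X ∩ Y)
    (hmaps : Set.MapsTo f X Y) (hlower : ∀ y ∈ Y, ∀ x ∈ X, y ≤ f x → y ∈ f '' X)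
    {p : Λ} (hp : p ∈ X ∩ Y) : f p = p := by
  refine Set.WellFoundedOn.induction hX (P := fun p => p ∈ Y → f p = p) hp.1 ?_ hp.2
  intro p hpX ih hpY
  rcases lt_trichotomy (f p) p with h | h | h
  · have hm := hlowY _ (hmaps hpX) p ⟨hpX, hpY⟩ h.le
    exact absurd (ih _ hm.1 h hm.2) (hsm hm.1 hpX h).ne
  · exact h
  · obtain ⟨q, hqX, hq⟩ := hlower p hpY p hpX h.le
    have hqp : q < p := (hsm.lt_iff_lt hqX hpX).1 (hq.trans_lt h)
    have hm := hlowX q hqX p ⟨hpX, hpY⟩ hqp.le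
    exact absurd ((ih q hqX hqp hm.2).symm.trans hq) hqp.ne

/-- A map realizing `F(f)` on `F(X)` fixes `S(Z)` when `f` fixes every point of `Z ⊆ X`. -/
theorem IsFHomOn.eq_self_of_mem_SX {D : Type*} [SemilatticeSup D] [OrderBot D] {Λ : Type*}
    [LinearOrder Λ] {sd : SLamData D Λ} {tw : RTower D (sd.SX Set.univ)} {X Z : Set Λ}
    {f : Λ → Λ} {ψ : D → D} (hψ : IsFHomOn sd tw X f ψ) (hZX : Z ⊆ X)
    (hf : ∀ i ∈ Z, f i = i) {d : D} (hd : d ∈ sd.SX Z) : ψ d = d := by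
  obtain ⟨h0, ha, hb, hc, hsup, -⟩ := hψ
  have hFX : sd.SX X ⊆ tw.FX (sd.SX X) := fun z hz => Set.mem_iUnion.2 ⟨0, hz⟩
  have hgen : {⊥, sd.a, sd.b, sd.a ⊔ sd.b} ⊆ sd.SX X :=
    Set.subset_union_left.trans subset_supClosure
  refine supClosure_min (t := {d | d ∈ sd.SX X ∧ ψ d = d}) ?_ ?_ hd |>.2
  · rintro d (hd | ⟨i, hi, rfl⟩)
    · refine ⟨hgen hd, ?_⟩
      rcases hd with rfl | rfl | rfl | rfl
      · exact h0
      · exact ha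
      · exact hb
      · rw [hsup _ _ (hFX (hgen (by simp))) (hFX (hgen (by simp))), ha, hb]
    · exact ⟨subset_supClosure (Or.inr ⟨i, hZX hi, rfl⟩), by rw [hc i (hZX hi), hf i hi]⟩
  · rintro u ⟨hu, hu'⟩ v ⟨hv, hv'⟩
    exact ⟨supClosed_supClosure hu hv, by rw [hsup u v (hFX hu) (hFX hv), hu', hv']⟩

/-- A map realizing `F(f)` on `F(X)` fixes `F(Z)` when `f` fixes every point of `Z ⊆ X`. -/
theorem IsFHomOn.eq_self_of_mem_FX {D : Type*} [SemilatticeSup D] [OrderBot D] {Λ : Type*}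
    [LinearOrder Λ] {sd : SLamData D Λ} {tw : RTower D (sd.SX Set.univ)} {X Z : Set Λ}
    {f : Λ → Λ} {ψ : D → D} (hψ : IsFHomOn sd tw X f ψ) (hZX : Z ⊆ X)
    (hf : ∀ i ∈ Z, f i = i) {d : D} (hd : d ∈ tw.FX (sd.SX Z)) : ψ d = d := by
  obtain ⟨n, hn⟩ := Set.mem_iUnion.1 hd
  clear hd
  induction n generalizing d with
  | zero => exact hψ.eq_self_of_mem_SX hZX hf hn
  | succ n ih =>
    obtain ⟨x, rfl, hx⟩ := hn
    have hmono := tw.FXn_mono (sd.SX_mono hZX) n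
    have hfix : Set.EqOn (tripleMap ψ) id x.1 := fun t ht => by
      obtain ⟨h₁, h₂, h₃⟩ := hx t ht
      simp [tripleMap, ih h₁, ih h₂, ih h₃]
    refine hψ.2.2.2.2.2 n x x (fun t ht => ?_) (by rw [hfix.image_eq, Set.image_id])
    exact ⟨hmono (hx t ht).1, hmono (hx t ht).2.1, hmono (hx t ht).2.2⟩

/-- if `X`, `Y` are well-ordered subsets of `Λ` with `otp X ≤ otp Y`
(witnessed by the unique order-embedding `f = e_{X,Y} : X → Y` whose range is a lower
subset of `Y`), and `X ∩ Y` is a lower subset of both `X` and `Y`, then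
`x[Y/X] = F(e_{X,Y})(x) = x` for every `x ∈ F(X ∩ Y)`. -/
theorem FX_map_fixes_intersection (Λ : Type*) [LinearOrder Λ]
    (D : Type*) [SemilatticeSup D] [OrderBot D]
    (sd : SLamData D Λ) (tw : RTower D (sd.SX Set.univ))
    (X Y : Set Λ) (hX : X.IsWF) (hY : Y.IsWF)
    (hlowX : ∀ p ∈ X, ∀ q ∈ X ∩ Y, p ≤ q → p ∈ X ∩ Y)
    (hlowY : ∀ p ∈ Y, ∀ q ∈ X ∩ Y, p ≤ q → p ∈ X ∩ Y)
    (f : Λ → Λ) (hmaps : Set.MapsTo f X Y) (hsm : StrictMonoOn f X)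
    (hlower : ∀ y ∈ Y, ∀ x ∈ X, y ≤ f x → y ∈ f '' X)
    (ψ : D → D) (hψ : IsFHomOn sd tw X f ψ)
    (x : D) (hx : x ∈ tw.FX (sd.SX (X ∩ Y))) :
    ψ x = x := by
  exact hψ.eq_self_of_mem_FX Set.inter_subset_left
    (fun _ hi => hsm.eq_self_of_mem_inter hX hlowX hlowY hmaps hlower hi) hx
end

section
/- (Interpolation Lemma) Let Λ be a chain, let X and Y be finite subsets of Λ, and let x ∈ F(X), y ∈ F(Y). If x ≤ y in F(Λ), then either there exists z ∈ F(X ∩ Y) such that x ≤ z ≤ y, or Y ⊄ X and c_{min(Y∖X)} ≤ y. -/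
section TowerLemmas

variable {D : Type*} [SemilatticeSup D]

theorem isReducedIn_singleton {A : Set D} {d : D} (hd : d ∈ A) :
    IsReducedIn A {(d, d, d)} := by
  refine ⟨Set.finite_singleton _, ?_, ⟨d, rfl, ?_⟩, ?_, ?_⟩
  · rintro t rfl
    exact ⟨hd, hd, hd, le_sup_left⟩
  · rintro u hu
    exact congrArg Prod.fst hu
  · rintro u v w huv -
    simp_all
  · rintro p u v w hp huv hne
    simp_all

variable [OrderBot D]

theorem IsReducedIn.piIn_eq {A : Set D} {x : Set (D × D × D)} (hx : IsReducedIn A x) {u : D}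
    (hu : (u, u, u) ∈ x) : piIn x = u := by
  have h : ∃ u : D, (u, u, u) ∈ x := ⟨u, hu⟩
  rw [piIn, dif_pos h]
  exact hx.2.2.1.unique h.choose_spec hu

namespace RTower

variable {S0 : Set D} (tw : RTower D S0)

theorem FXn_subset_T {B : Set D} (hB : B ⊆ S0) : ∀ n, tw.FXn B n ⊆ tw.T n
  | 0 => by rw [tw.T_zero]; exact hB
  | n + 1 => by
    rintro d ⟨x, rfl, -⟩
    rw [← tw.phi_range]
    exact ⟨x, rfl⟩

theorem FXn_monotone {B : Set D} (hB : B ⊆ S0) : Monotone (tw.FXn B) := by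
  refine monotone_nat_of_le_succ fun n d hd => ?_
  refine ⟨⟨_, isReducedIn_singleton (tw.FXn_subset_T hB n hd)⟩, tw.phi_diag n _ d rfl, ?_⟩
  rintro t rfl
  exact ⟨hd, hd, hd⟩

theorem FXn_inter_subset (B C : Set D) :
    ∀ n, tw.FXn B n ∩ tw.FXn C n ⊆ tw.FXn (B ∩ C) n
  | 0 => subset_rfl
  | n + 1 => by
    rintro d ⟨⟨x, rfl, hx⟩, ⟨y, hyx, hy⟩⟩
    obtain rfl := tw.phi_inj n hyx
    exact ⟨y, rfl, fun t ht =>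
      ⟨FXn_inter_subset B C n ⟨(hx t ht).1, (hy t ht).1⟩,
        FXn_inter_subset B C n ⟨(hx t ht).2.1, (hy t ht).2.1⟩,
        FXn_inter_subset B C n ⟨(hx t ht).2.2, (hy t ht).2.2⟩⟩⟩

/-- The diagonal coordinate of a reduced set lies below the element it represents. -/
theorem le_phi_of_diag_mem {n : ℕ} (y : {x : Set (D × D × D) // IsReducedIn (tw.T n) x}) {q : D}
    (hq : (q, q, q) ∈ y.1) : q ≤ tw.φ n y := by
  have hqT : q ∈ tw.T n := (y.2.2.1 _ hq).1
  rw [← tw.phi_diag n ⟨_, isReducedIn_singleton hqT⟩ q rfl, tw.phi_le]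
  rintro t ⟨rfl, ht⟩
  exact absurd hq ht

/-- Simultaneous interpolation propagates through the levels of the tower: if any `y` in the
bottom level `C` either satisfies the upward closed property `P` or lies in `B ∩ C`, then below
any `y` of level `n` over `C`, not satisfying `P`, finitely many elements of level `n` over `B`
have a common upper bound of level `n` over `B ∩ C`. -/
theorem exists_interpolant {B C : Set D} (hC : C ⊆ S0) {P : D → Prop}
    (hP : ∀ d e, d ≤ e → P d → P e) (h0 : ∀ y ∈ C, P y ∨ y ∈ B ∩ C) :
    ∀ n, ∀ A ⊆ tw.FXn B n, A.Finite → ∀ y ∈ tw.FXn C n, (∀ x ∈ A, x ≤ y) →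
      P y ∨ ∃ z ∈ tw.FXn (B ∩ C) n, (∀ x ∈ A, x ≤ z) ∧ z ≤ y
  | 0 => fun _ _ _ y hy hAy => (h0 y hy).imp id fun h => ⟨y, h, hAy, le_rfl⟩
  | n + 1 => by
    rintro A hAB hA _ ⟨y, rfl, hy⟩ hAy
    obtain ⟨q, hq, -⟩ := y.2.2.2.1
    have hpiq := y.2.piIn_eq hq
    have : Nonempty {x : Set (D × D × D) // IsReducedIn (tw.T n) x} := ⟨y⟩
    have hrep : ∀ x ∈ A, ∃ s : {x : Set (D × D × D) // IsReducedIn (tw.T n) x}, tw.φ n s = x ∧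
        ∀ t ∈ s.1, t.1 ∈ tw.FXn B n ∧ t.2.1 ∈ tw.FXn B n ∧ t.2.2 ∈ tw.FXn B n := fun _ hx => hAB hx
    choose! f hf hfB using hrep
    let U : Set (D × D × D) := ⋃ x ∈ A, (f x).1
    have hU : U.Finite := hA.biUnion fun x _ => (f x).2.1
    have hUB : ∀ t ∈ U, t.1 ∈ tw.FXn B n ∧ t.2.1 ∈ tw.FXn B n ∧ t.2.2 ∈ tw.FXn B n := by
      intro t ht
      obtain ⟨x, hx, htx⟩ := Set.mem_iUnion₂.1 ht
      exact hfB x hx t htx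
    let E : Set D := (Prod.fst '' U ∪ (fun t => t.2.2) '' U) ∩ Set.Iic q
    have hE : E ⊆ tw.FXn B n := by
      rintro _ ⟨⟨t, ht, rfl⟩ | ⟨t, ht, rfl⟩, -⟩
      exacts [(hUB t ht).1, (hUB t ht).2.2]
    rcases exists_interpolant hC hP h0 n E hE
      (((hU.image _).union (hU.image _)).inter_of_left _) q (hy _ hq).1 (fun _ hd => hd.2)
      with hPq | ⟨p, hp, hEp, hpq⟩
    · exact Or.inl (hP _ _ (tw.le_phi_of_diag_mem y hq) hPq)
    right
    have hpT : p ∈ tw.T n := tw.FXn_subset_T (Set.inter_subset_right.trans hC) n hp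
    let Z : Set (D × D × D) := insert (p, p, p) ((U ∩ y.1) \ {(q, q, q)})
    have hdiag : ∀ u, (u, u, u) ∈ Z → u = p := by
      rintro u (h | ⟨⟨-, h⟩, hne⟩)
      · exact congrArg Prod.fst h
      · exact absurd (by rw [y.2.2.2.1.unique h hq]; rfl) hne
    have hZ : IsReducedIn (tw.T n) Z := by
      refine ⟨((hU.inter_of_left _).sdiff).insert _, ?_, ⟨p, Or.inl rfl, hdiag⟩, ?_, ?_⟩
      · rintro t (rfl | ht)
        · exact ⟨hpT, hpT, hpT, le_sup_left⟩
        · exact y.2.2.1 t ht.1.2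
      · rintro u v w (h | h) h'
        · simp_all
        · rcases h' with h' | h'
          · simp_all
          · exact y.2.2.2.2.1 u v w h.1.2 h'.1.2
      · rintro p' u v w hp' h hne
        obtain rfl := hdiag _ hp'
        obtain ⟨hu, hv, hw⟩ := y.2.2.2.2.2 q u v w hq (h.resolve_left hne).1.2
          (h.resolve_left hne).2
        exact ⟨fun h => hu (h.trans hpq), fun h => hv (h.trans hpq), fun h => hw (h.trans hpq)⟩
    have hpip : piIn Z = p := hZ.piIn_eq (Or.inl rfl)
    refine ⟨tw.φ n ⟨Z, hZ⟩, ⟨⟨Z, hZ⟩, rfl, ?_⟩, ?_, ?_⟩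
    · rintro t (rfl | ht)
      · exact ⟨hp, hp, hp⟩
      · have hB := hUB t ht.1.1
        have hC := hy t ht.1.2
        exact ⟨tw.FXn_inter_subset B C n ⟨hB.1, hC.1⟩,
          tw.FXn_inter_subset B C n ⟨hB.2.1, hC.2.1⟩,
          tw.FXn_inter_subset B C n ⟨hB.2.2, hC.2.2⟩⟩
    · intro x hx
      have hxy := hAy x hx
      rw [← hf x hx, tw.phi_le] at hxy ⊢
      rintro t ⟨htx, htZ⟩
      have htU : t ∈ U := Set.mem_biUnion hx htx
      change t.1 ≤ piIn Z ∨ t.2.2 ≤ piIn Z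
      rw [hpip]
      by_cases hty : t ∈ y.1
      · obtain rfl : t = (q, q, q) := by
          by_contra hne
          exact htZ (Or.inr ⟨⟨htU, hty⟩, hne⟩)
        exact Or.inl (hEp _ ⟨Or.inl ⟨_, htU, rfl⟩, le_rfl⟩)
      · have h := hxy t ⟨htx, hty⟩
        rw [hpiq] at h
        exact h.imp (fun h => hEp _ ⟨Or.inl ⟨_, htU, rfl⟩, h⟩)
          fun h => hEp _ ⟨Or.inr ⟨_, htU, rfl⟩, h⟩
    · rw [tw.phi_le]
      rintro t ⟨rfl | ht, hty⟩
      · exact Or.inl (hpiq ▸ hpq)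
      · exact absurd ht.1.2 hty

end RTower

end TowerLemmas

namespace SLamData

variable {D : Type*} [SemilatticeSup D] [OrderBot D] {Λ : Type*} [LinearOrder Λ]
  (sd : SLamData D Λ)

theorem SX_mono_s10 {X Y : Set Λ} (h : X ⊆ Y) : sd.SX X ⊆ sd.SX Y :=
  supClosure_mono (Set.union_subset_union_right _ (Set.image_mono h))

theorem c_sup_c (i j : Λ) : sd.c i ⊔ sd.c j = sd.c (max i j) := by
  rcases le_total i j with h | h <;> simp [h, sd.c_mono h]

/-- Normal forms of the elements of `S(X)`. -/
theorem mem_SX {X : Set Λ} {d : D} : d ∈ sd.SX X ↔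
    (d = ⊥ ∨ d = sd.a ∨ d = sd.b ∨ d = sd.a ⊔ sd.b) ∨
    ∃ i ∈ X, d = sd.c i ∨ d = sd.a ⊔ sd.c i ∨ d = sd.b ⊔ sd.c i := by
  constructor
  · intro hd
    let N : Set D := {d | (d = ⊥ ∨ d = sd.a ∨ d = sd.b ∨ d = sd.a ⊔ sd.b) ∨
      ∃ i ∈ X, d = sd.c i ∨ d = sd.a ⊔ sd.c i ∨ d = sd.b ⊔ sd.c i}
    have habs : ∀ e ≤ sd.a ⊔ sd.b, e ⊔ (sd.a ⊔ sd.b) = sd.a ⊔ sd.b := fun e he => by simpa using he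
    have hbot : (⊥ : D) ∈ N := by simp [N]
    have ha : ∀ e ∈ N, sd.a ⊔ e ∈ N := by
      rintro e ((rfl | rfl | rfl | rfl) | ⟨i, hi, rfl | rfl | rfl⟩)
      any_goals simp [N]; done
      · exact Or.inr ⟨i, hi, by simp⟩
      · exact Or.inr ⟨i, hi, by simp⟩
      · refine Or.inl (Or.inr (Or.inr (Or.inr ?_)))
        rw [← sup_assoc]
        simpa using sd.c_le_ab i
    have hb : ∀ e ∈ N, sd.b ⊔ e ∈ N := by
      rintro e ((rfl | rfl | rfl | rfl) | ⟨i, hi, rfl | rfl | rfl⟩)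
      any_goals simp [N, sup_comm]; done
      · exact Or.inr ⟨i, hi, by simp⟩
      · refine Or.inl (Or.inr (Or.inr (Or.inr ?_)))
        rw [← sup_assoc, sup_comm sd.b]
        simpa using sd.c_le_ab i
      · exact Or.inr ⟨i, hi, by simp⟩
    have hc : ∀ i ∈ X, ∀ e ∈ N, sd.c i ⊔ e ∈ N := by
      have hmax : ∀ i ∈ X, ∀ j ∈ X, max i j ∈ X := fun i hi j hj => by
        rcases max_choice i j with h | h <;> rw [h] <;> assumption
      rintro i hi e ((rfl | rfl | rfl | rfl) | ⟨j, hj, rfl | rfl | rfl⟩)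
      · exact Or.inr ⟨i, hi, by simp⟩
      · exact Or.inr ⟨i, hi, by simp [sup_comm]⟩
      · exact Or.inr ⟨i, hi, by simp [sup_comm]⟩
      · rw [habs _ (sd.c_le_ab i)]
        simp [N]
      · exact Or.inr ⟨_, hmax i hi j hj, by simp [c_sup_c]⟩
      · exact Or.inr ⟨_, hmax i hi j hj, by simp [← c_sup_c, sup_left_comm]⟩
      · exact Or.inr ⟨_, hmax i hi j hj, by simp [← c_sup_c, sup_left_comm]⟩
    refine supClosure_min (t := N) ?_ ?_ hd
    · rintro e ((rfl | rfl | rfl | rfl) | ⟨i, hi, rfl⟩)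
      any_goals simp [N]; done
      exact Or.inr ⟨i, hi, Or.inl rfl⟩
    · rintro e ((rfl | rfl | rfl | rfl) | ⟨i, hi, rfl | rfl | rfl⟩) e' he'
      · rwa [bot_sup_eq]
      · exact ha _ he'
      · exact hb _ he'
      · rw [sup_assoc]
        exact ha _ (hb _ he')
      · exact hc i hi _ he'
      · rw [sup_assoc]
        exact ha _ (hc i hi _ he')
      · rw [sup_assoc]
        exact hb _ (hc i hi _ he')
  · have hsup : SupClosed (sd.SX X) := supClosed_supClosure
    have hgen : ({⊥, sd.a, sd.b, sd.a ⊔ sd.b} ∪ sd.c '' X : Set D) ⊆ sd.SX X := subset_supClosure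
    rintro ((rfl | rfl | rfl | rfl) | ⟨i, hi, h⟩)
    iterate 4 exact hgen (by simp)
    have hi' : sd.c i ∈ sd.SX X := hgen (Or.inr ⟨i, hi, rfl⟩)
    rcases h with rfl | rfl | rfl
    exacts [hi', hsup (hgen (by simp)) hi', hsup (hgen (by simp)) hi']

theorem c_le_c_iff {i j : Λ} : sd.c i ≤ sd.c j ↔ i ≤ j :=
  ⟨fun h => sd.c_le_a_sup_c i j (h.trans le_sup_right), fun h => sd.c_mono h⟩

theorem SX_inter (X Y : Set Λ) : sd.SX X ∩ sd.SX Y = sd.SX (X ∩ Y) := by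
  refine Set.Subset.antisymm ?_
    (Set.subset_inter (sd.SX_mono_s10 Set.inter_subset_left) (sd.SX_mono_s10 Set.inter_subset_right))
  rintro d ⟨hX, hY⟩
  rw [mem_SX] at hX hY ⊢
  rcases hX with hX | ⟨i, hi, hX⟩
  · exact Or.inl hX
  rcases hY with hY | ⟨j, hj, hY⟩
  · exact Or.inl hY
  suffices hij : i = j by
    subst hij
    exact Or.inr ⟨i, ⟨hi, hj⟩, hX⟩
  have key : ∀ k l, (d = sd.c k ∨ d = sd.a ⊔ sd.c k ∨ d = sd.b ⊔ sd.c k) →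
      (d = sd.c l ∨ d = sd.a ⊔ sd.c l ∨ d = sd.b ⊔ sd.c l) → k ≤ l := by
    intro k l hk hl
    have hkd : sd.c k ≤ d := by rcases hk with rfl | rfl | rfl <;> simp
    rcases hl with rfl | rfl | rfl
    · exact sd.c_le_c_iff.1 hkd
    · exact sd.c_le_a_sup_c k l hkd
    · exact sd.c_le_b_sup_c k l hkd
  exact le_antisymm (key i j hX hY) (key j i hY hX)

/-- An element of `S(Y)` that is not above `c m`, where `m` is the least element of `Y \ X`,
lies in `S(X ∩ Y)`. -/
theorem c_le_or_mem_SX_inter {X Y : Set Λ} {m : Λ} (hm : IsLeast (Y \ X) m) {y : D}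
    (hy : y ∈ sd.SX Y) : sd.c m ≤ y ∨ y ∈ sd.SX (X ∩ Y) := by
  rw [mem_SX] at hy ⊢
  rcases hy with hy | ⟨j, hj, hy⟩
  · exact Or.inr (Or.inl hy)
  by_cases hjX : j ∈ X
  · exact Or.inr (Or.inr ⟨j, ⟨hjX, hj⟩, hy⟩)
  · have hmj : sd.c m ≤ sd.c j := sd.c_mono (hm.2 ⟨hj, hjX⟩)
    refine Or.inl (hmj.trans ?_)
    rcases hy with rfl | rfl | rfl <;> simp

end SLamData

/-- Interpolation Lemma: for finite `X, Y ⊆ Λ`, `x ∈ F(X)`, `y ∈ F(Y)`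
with `x ≤ y`, either there is `z ∈ F(X ∩ Y)` with `x ≤ z ≤ y`, or `Y ⊄ X` and
`c_{min (Y \ X)} ≤ y`. -/
theorem interpolation_lemma (Λ : Type*) [LinearOrder Λ]
    (D : Type*) [SemilatticeSup D] [OrderBot D]
    (sd : SLamData D Λ) (tw : RTower D (sd.SX Set.univ))
    (X Y : Set Λ) (hX : X.Finite) (hY : Y.Finite)
    (x y : D) (hx : x ∈ tw.FX (sd.SX X)) (hy : y ∈ tw.FX (sd.SX Y)) (hxy : x ≤ y) :
    (∃ z ∈ tw.FX (sd.SX (X ∩ Y)), x ≤ z ∧ z ≤ y) ∨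
    (¬ Y ⊆ X ∧ ∃ m : Λ, IsLeast (Y \ X) m ∧ sd.c m ≤ y) := by
  have hsub : ∀ Z : Set Λ, sd.SX Z ⊆ sd.SX Set.univ := fun Z => sd.SX_mono_s10 (Set.subset_univ Z)
  have h0 : ∀ d ∈ sd.SX Y, (¬ Y ⊆ X ∧ ∃ m : Λ, IsLeast (Y \ X) m ∧ sd.c m ≤ d) ∨
      d ∈ sd.SX X ∩ sd.SX Y := by
    intro d hd
    by_cases hYX : Y ⊆ X
    · exact Or.inr ⟨sd.SX_mono_s10 hYX hd, hd⟩
    · obtain ⟨m, hm⟩ : ∃ m, IsLeast (Y \ X) m :=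
        (hY.sdiff).exists_minimal (Set.sdiff_nonempty.2 hYX) |>.imp fun m hm =>
          ⟨hm.1, fun j hj => (le_total m j).elim id (hm.2 hj)⟩
      rw [sd.SX_inter]
      exact (sd.c_le_or_mem_SX_inter hm hd).imp (fun h => ⟨hYX, m, hm, h⟩) id
  obtain ⟨k, hk⟩ := Set.mem_iUnion.1 hx
  obtain ⟨l, hl⟩ := Set.mem_iUnion.1 hy
  have hxn := tw.FXn_monotone (hsub X) (le_max_left k l) hk
  have hyn := tw.FXn_monotone (hsub Y) (le_max_right k l) hl
  rcases tw.exists_interpolant (hsub Y)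
      (fun d e hde ⟨hYX, m, hm, h⟩ => ⟨hYX, m, hm, h.trans hde⟩) h0 (max k l) {x}
      (Set.singleton_subset_iff.2 hxn) (Set.finite_singleton x) y hyn
      (fun _ h => h ▸ hxy) with h | ⟨z, hz, hxz, hzy⟩
  · exact Or.inr h
  · rw [sd.SX_inter] at hz
    exact Or.inl ⟨z, Set.mem_iUnion.2 ⟨_, hz⟩, hxz x rfl, hzy⟩
end

section
/- Let Λ be a chain and let X be a nonempty subset of Λ admitting a supremum ξ in Λ. Then c_ξ is the supremum of the set {c_i : i ∈ X} in F(Λ). -/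
section Helpers

variable {D : Type*} [SemilatticeSup D] [OrderBot D]

theorem isReducedIn_singleton_s11 {D : Type*} [SemilatticeSup D] {A : Set D} {a : D} (ha : a ∈ A) :
    IsReducedIn A {(a, a, a)} := by
  refine ⟨Set.finite_singleton _, ?_, ⟨a, rfl, ?_⟩, ?_, ?_⟩
  · rintro t rfl
    exact ⟨ha, ha, ha, le_sup_left⟩
  · intro u hu
    exact congrArg Prod.fst hu
  · intro u v w h _
    simp only [Set.mem_singleton_iff, Prod.mk.injEq] at h
    exact ⟨h.1.trans h.2.1.symm, h.2.1.trans h.2.2.symm⟩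
  · intro p u v w hp h hne
    exact absurd (Eq.trans h (Eq.symm hp)) hne

theorem IsReducedIn.piIn_mem {A : Set D} {x : Set (D × D × D)} (hx : IsReducedIn A x) :
    (piIn x, piIn x, piIn x) ∈ x := by
  have h : ∃ u : D, (u, u, u) ∈ x := hx.2.2.1.exists
  have hpi : piIn x = h.choose := dif_pos h
  rw [hpi]
  exact h.choose_spec

theorem IsReducedIn.rleIn_singleton_iff {A : Set D} {x : Set (D × D × D)}
    (hx : IsReducedIn A x) (a : D) : RleIn {(a, a, a)} x ↔ a ≤ piIn x := by
  constructor
  · intro h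
    by_cases ha : (a, a, a) ∈ x
    · exact (hx.2.2.1.unique ha hx.piIn_mem).le
    · exact or_self_iff.1 (h _ ⟨rfl, ha⟩)
  · rintro h _ ⟨rfl, _⟩
    exact Or.inl h

theorem RTower.le_phi_iff {S0 : Set D} (tw : RTower D S0) (n : ℕ) {a : D} (ha : a ∈ tw.T n)
    (y : {x : Set (D × D × D) // IsReducedIn (tw.T n) x}) :
    a ≤ tw.φ n y ↔ a ≤ piIn y.1 := by
  have h := tw.phi_le n ⟨_, isReducedIn_singleton_s11 ha⟩ y
  rwa [tw.phi_diag n _ a rfl, y.2.rleIn_singleton_iff] at h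

theorem RTower.T_mono {S0 : Set D} (tw : RTower D S0) : Monotone tw.T :=
  monotone_nat_of_le_succ fun n a ha => by
    rw [← tw.phi_range n]
    exact ⟨⟨_, isReducedIn_singleton_s11 ha⟩, tw.phi_diag n _ a rfl⟩

/-- Suprema in the bottom level of the tower remain suprema in the whole tower. -/
theorem RTower.isLUB_of_forall_mem {S0 : Set D} (tw : RTower D S0) {A : Set D} {s : D}
    (hA : A ⊆ S0) (hs : s ∈ S0) (hub : s ∈ upperBounds A)
    (hlub : ∀ d ∈ S0, d ∈ upperBounds A → s ≤ d) : IsLUB A s := by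
  have hS (n : ℕ) : S0 ⊆ tw.T n :=
    tw.T_zero.symm.subset.trans (tw.T_mono n.zero_le)
  have key (n : ℕ) : ∀ d ∈ tw.T n, d ∈ upperBounds A → s ≤ d := by
    induction n with
    | zero => rwa [tw.T_zero]
    | succ n ih =>
      intro d hd hdA
      rw [← tw.phi_range n] at hd
      obtain ⟨y, rfl⟩ := hd
      rw [tw.le_phi_iff n (hS n hs)]
      refine ih _ (y.2.2.1 _ y.2.piIn_mem).1 fun x hx => ?_
      exact (tw.le_phi_iff n (hS n (hA hx)) y).1 (hdA hx)
  refine ⟨hub, fun d hd => ?_⟩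
  obtain ⟨n, hn⟩ := Set.mem_iUnion.1 (tw.union_univ.symm ▸ Set.mem_univ d)
  exact key n d hn hd

variable {Λ : Type*} [LinearOrder Λ]

theorem SLamData.c_mem_SX (sd : SLamData D Λ) {X : Set Λ} {i : Λ} (hi : i ∈ X) :
    sd.c i ∈ sd.SX X :=
  subset_supClosure (Or.inr ⟨i, hi, rfl⟩)

theorem SLamData.supClosed_insert_bot_range_c (sd : SLamData D Λ) :
    SupClosed (insert ⊥ (Set.range sd.c)) := by
  rintro _ (rfl | ⟨i, rfl⟩) _ (rfl | ⟨j, rfl⟩)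
  · simp
  · simp
  · simp
  · exact Or.inr ⟨i ⊔ j, sd.c_mono.map_sup i j⟩

/-- Every element of `S(X)` is above `a ⊔ b` or is the join of one of `⊥`, `a`, `b` with
`⊥` or some `c j`. -/
theorem SLamData.le_or_eq_sup_of_mem_SX (sd : SLamData D Λ) {X : Set Λ} {d : D}
    (hd : d ∈ sd.SX X) :
    sd.a ⊔ sd.b ≤ d ∨ ∃ e ∈ ({⊥, sd.a, sd.b} : Set D),
      ∃ g ∈ insert ⊥ (Set.range sd.c), d = e ⊔ g := by
  refine supClosure_min (t := {d | sd.a ⊔ sd.b ≤ d ∨ ∃ e ∈ ({⊥, sd.a, sd.b} : Set D),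
      ∃ g ∈ insert ⊥ (Set.range sd.c), d = e ⊔ g}) ?_ ?_ hd
  · rintro x ((rfl | rfl | rfl | rfl) | ⟨j, _, rfl⟩)
    · exact Or.inr ⟨⊥, by simp, ⊥, by simp, by simp⟩
    · exact Or.inr ⟨sd.a, by simp, ⊥, by simp, by simp⟩
    · exact Or.inr ⟨sd.b, by simp, ⊥, by simp, by simp⟩
    · exact Or.inl le_rfl
    · exact Or.inr ⟨⊥, by simp, sd.c j, by simp, by simp⟩
  · rintro x (hx | ⟨e, he, g, hg, rfl⟩) y (hy | ⟨e', he', g', hg', rfl⟩)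
    · exact Or.inl (hx.trans le_sup_left)
    · exact Or.inl (hx.trans le_sup_left)
    · exact Or.inl (hy.trans le_sup_right)
    · have hee : sd.a ⊔ sd.b ≤ e ⊔ e' ∨ e ⊔ e' ∈ ({⊥, sd.a, sd.b} : Set D) := by
        rcases he with rfl | rfl | rfl <;> rcases he' with rfl | rfl | rfl <;>
          simp [sup_comm]
      rw [Set.mem_ofPred_eq, sup_sup_sup_comm]
      exact hee.imp (fun h => h.trans le_sup_left) fun h =>
        ⟨_, h, _, sd.supClosed_insert_bot_range_c hg hg', rfl⟩

/-- If `d ∈ S(X)` is above some `c i`, then either `d` is above all `c k`, or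
it is above a largest `c j`. -/
theorem SLamData.forall_c_le_or_exists_c_le_iff (sd : SLamData D Λ) {X : Set Λ} {d : D}
    (hd : d ∈ sd.SX X) {i : Λ} (hi : sd.c i ≤ d) :
    (∀ k, sd.c k ≤ d) ∨ ∃ j, ∀ k, sd.c k ≤ d ↔ k ≤ j := by
  rcases sd.le_or_eq_sup_of_mem_SX hd with h | ⟨e, he, g, rfl | ⟨j, rfl⟩, rfl⟩
  · exact Or.inl fun k => (sd.c_le_ab k).trans h
  · rw [sup_bot_eq] at hi
    rcases he with rfl | rfl | rfl
    · exact absurd (hi.trans bot_le) (sd.not_c_le_a i)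
    · exact absurd hi (sd.not_c_le_a i)
    · exact absurd hi (sd.not_c_le_b i)
  · refine Or.inr ⟨j, fun k => ⟨fun hk => ?_, fun hk => (sd.c_mono hk).trans le_sup_right⟩⟩
    rcases he with rfl | rfl | rfl
    · exact sd.c_le_a_sup_c k j (hk.trans (sup_le_sup_right bot_le _))
    · exact sd.c_le_a_sup_c k j hk
    · exact sd.c_le_b_sup_c k j hk

end Helpers

/-- if a nonempty `X ⊆ Λ` has a supremum `ξ` in `Λ`, then `c_ξ` is the
supremum of `{cᵢ : i ∈ X}` in `F(Λ)` (realized as the ambient semilattice `D`). -/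
theorem c_isLUB (Λ : Type*) [LinearOrder Λ]
    (D : Type*) [SemilatticeSup D] [OrderBot D]
    (sd : SLamData D Λ) (tw : RTower D (sd.SX Set.univ))
    (X : Set Λ) (hne : X.Nonempty) (ξ : Λ) (hξ : IsLUB X ξ) :
    IsLUB (sd.c '' X) (sd.c ξ) := by
  refine tw.isLUB_of_forall_mem ?_ (sd.c_mem_SX (Set.mem_univ ξ)) ?_ fun d hd hdX => ?_
  · rintro _ ⟨i, _, rfl⟩
    exact sd.c_mem_SX (Set.mem_univ i)
  · rintro _ ⟨i, hi, rfl⟩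
    exact sd.c_mono (hξ.1 hi)
  have hc (i : Λ) (hi : i ∈ X) : sd.c i ≤ d := hdX ⟨i, hi, rfl⟩
  obtain ⟨i₀, hi₀⟩ := hne
  rcases sd.forall_c_le_or_exists_c_le_iff hd (hc i₀ hi₀) with h | ⟨j, hj⟩
  · exact h ξ
  · exact (hj ξ).2 (hξ.2 fun i hi => (hj i).1 (hc i hi))
end

section
/- Let σ = (x_ξ)_{ξ<ω₁} be an isotone ω₁-indexed sequence of elements of F(ω₁) (i.e., ξ ≤ η implies x_ξ ≤ x_η). Then either σ is eventually constant, or there exists a closed unbounded subset C of ω₁ such that c_ξ ≤ x_ξ for all ξ ∈ C. -/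
/-- The first uncountable ordinal `ω₁`, viewed as a chain: the linearly ordered set of
all ordinals `< ω₁`. -/
noncomputable abbrev Omega1 : Type 1 := {o : Ordinal // o < (Cardinal.aleph 1).ord}

/-- `C` is a closed unbounded subset of `ω₁`: it is unbounded, and the supremum of any
nonempty (bounded) subset of `C` belongs to `C`. -/
def ClosedUnbounded (C : Set Omega1) : Prop :=
  (∀ ξ : Omega1, ∃ η ∈ C, ξ ≤ η) ∧
  ∀ s ⊆ C, s.Nonempty → ∀ ξ : Omega1, IsLUB s ξ → ξ ∈ C

section Omega1

theorem Omega1.exists_gt (ξ : Omega1) : ∃ η : Omega1, ξ < η :=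
  ⟨⟨Order.succ ξ.1, (Cardinal.isSuccLimit_ord (Cardinal.aleph0_le_aleph 1)).succ_lt ξ.2⟩,
    Order.lt_succ ξ.1⟩

theorem Omega1.bddAbove_range {ι : Type} [Countable ι] (f : ι → Omega1) :
    ∃ β, ∀ i, f i ≤ β := by
  have h : (⨆ i, (f i).1) < (Cardinal.aleph 1).ord :=
    (Ordinal.iSup_lt_omega_one fun i => (f i).2.trans_eq (Cardinal.ord_aleph 1)).trans_eq
      (Cardinal.ord_aleph 1).symm
  exact ⟨⟨_, h⟩, fun i => Ordinal.le_iSup (fun i => (f i).1) i⟩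

theorem Omega1.countable_Iio (η : Omega1) : (Set.Iio η).Countable := by
  have h : (Set.Iio η.1).Countable := by
    rw [← Cardinal.le_aleph0_iff_set_countable, Cardinal.mk_Iio_ordinal,
      Cardinal.lift_le_aleph0, ← Order.lt_succ_iff, Cardinal.succ_aleph0]
    exact Cardinal.lt_ord.1 η.2
  exact h.preimage Subtype.val_injective

/-- A map from `ω₁` with countable range takes some value unboundedly often. -/
theorem Omega1.exists_unbounded_fiber {α : Type*} (f : Omega1 → α)
    (hf : (Set.range f).Countable) : ∃ v, ∀ ξ, ∃ ζ, ξ ≤ ζ ∧ f ζ = v := by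
  obtain ⟨e, he⟩ := hf.exists_eq_range ⟨_, Set.mem_range_self ⟨0, by
    rw [Cardinal.ord_aleph]; exact Ordinal.omega_pos 1⟩⟩
  by_contra! H
  choose b hb using H
  obtain ⟨β, hβ⟩ := Omega1.bddAbove_range fun n : ℕ => b (e n)
  obtain ⟨n, hn⟩ : f β ∈ Set.range e := he ▸ Set.mem_range_self β
  exact hb (e n) β (hβ n) hn.symm

theorem Omega1.eventually_const_of_unbounded_fiber {α : Type*} [PartialOrder α] {f : Omega1 → α}
    (hf : Monotone f) {v : α} (hv : ∀ ξ, ∃ ζ, ξ ≤ ζ ∧ f ζ = v) :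
    ∃ η, ∀ ξ, η ≤ ξ → f ξ = f η := by
  obtain ⟨η, -, rfl⟩ := hv ⟨0, by rw [Cardinal.ord_aleph]; exact Ordinal.omega_pos 1⟩
  refine ⟨η, fun ξ h => le_antisymm ?_ (hf h)⟩
  obtain ⟨ζ, h1, h2⟩ := hv ξ
  exact h2 ▸ hf h1

theorem Omega1.eventually_const_of_countable_range {α : Type*} [PartialOrder α] {f : Omega1 → α}
    (hf : Monotone f) (hc : (Set.range f).Countable) : ∃ η, ∀ ξ, η ≤ ξ → f ξ = f η :=
  let ⟨_, hv⟩ := Omega1.exists_unbounded_fiber f hc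
  Omega1.eventually_const_of_unbounded_fiber hf hv

theorem Omega1.exists_isLUB_range (f : ℕ → Omega1) : ∃ ξ, IsLUB (Set.range f) ξ := by
  obtain ⟨β, hβ⟩ := Omega1.bddAbove_range f
  have hne : (upperBounds (Set.range f)).Nonempty := ⟨β, by rintro _ ⟨i, rfl⟩; exact hβ i⟩
  exact ⟨wellFounded_lt.min _ hne, wellFounded_lt.min_mem _ hne,
    fun z hz => wellFounded_lt.min_le hz⟩

end Omega1

theorem isReducedIn_diag {D : Type*} [SemilatticeSup D] {A : Set D} {d : D} (hd : d ∈ A) :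
    IsReducedIn A {(d, d, d)} := by
  refine ⟨Set.finite_singleton _, ?_, ⟨d, rfl, ?_⟩, ?_, ?_⟩
  · rintro t rfl
    exact ⟨hd, hd, hd, le_sup_left⟩
  · intro u hu
    simpa using hu
  · intro u v w h _
    simp only [Set.mem_singleton_iff, Prod.mk.injEq] at h
    obtain ⟨rfl, rfl, rfl⟩ := h
    exact ⟨rfl, rfl⟩
  · intro p u v w hp h hne
    exact absurd (h.trans hp.symm) hne

section Tower

variable {D : Type*} [SemilatticeSup D] [OrderBot D]

theorem IsReducedIn.piIn_mem_base {A : Set D} {x : Set (D × D × D)} (hx : IsReducedIn A x) :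
    piIn x ∈ A :=
  (hx.2.1 _ hx.piIn_mem).1

theorem IsReducedIn.subset_of_rleIn {A : Set D} {x y : Set (D × D × D)}
    (hx : IsReducedIn A x) (hxy : RleIn x y) (hpi : piIn x = piIn y) (hy : IsReducedIn A y) :
    x ⊆ y := by
  rintro ⟨u, v, w⟩ ht
  by_contra hty
  have hne : (u, v, w) ≠ (piIn x, piIn x, piIn x) := by
    intro h
    exact hty (by rw [h, hpi]; exact hy.piIn_mem)
  obtain ⟨hu, -, hw⟩ := hx.2.2.2.2 _ u v w hx.piIn_mem ht hne
  rcases hxy _ ⟨ht, hty⟩ with h | h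
  · exact hu (hpi ▸ h)
  · exact hw (hpi ▸ h)

namespace RTower

variable {S0 : Set D} (tw : RTower D S0)

theorem T_subset_succ (n : ℕ) : tw.T n ⊆ tw.T (n + 1) := by
  intro d hd
  rw [← tw.phi_range]
  exact ⟨⟨_, isReducedIn_diag hd⟩, tw.phi_diag n _ d rfl⟩

theorem base_subset_T (n : ℕ) : S0 ⊆ tw.T n := by
  induction n with
  | zero => exact tw.T_zero.ge
  | succ n ih => exact ih.trans (tw.T_subset_succ n)

/-- An element of `T n` lies below `x ∈ R(T n)` iff it lies below `π(x)`. -/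
theorem le_phi_iff_s12 {n : ℕ} {d : D} (hd : d ∈ tw.T n)
    (r : {x : Set (D × D × D) // IsReducedIn (tw.T n) x}) :
    d ≤ tw.φ n r ↔ d ≤ piIn r.1 := by
  have h := tw.phi_le n ⟨_, isReducedIn_diag hd⟩ r
  rw [tw.phi_diag n _ d rfl] at h
  rw [h]
  constructor
  · intro hle
    by_cases hmem : (d, d, d) ∈ r.1
    · exact (r.2.2.2.1.unique hmem r.2.piIn_mem).le
    · exact (hle _ ⟨rfl, hmem⟩).elim id id
  · rintro hle t ⟨rfl, -⟩
    exact Or.inl hle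

theorem piIn_mono {n : ℕ} {r s : {x : Set (D × D × D) // IsReducedIn (tw.T n) x}}
    (h : tw.φ n r ≤ tw.φ n s) : piIn r.1 ≤ piIn s.1 :=
  (tw.le_phi_iff_s12 r.2.piIn_mem_base s).1
    (((tw.le_phi_iff_s12 r.2.piIn_mem_base r).2 le_rfl).trans h)

/-- If isotone `ω₁`-sequences in `S0` avoiding the principal filter of `d` are eventually
constant, then so are those in `D`. -/
theorem eventually_const_of_not_le (tw : RTower D S0) {d : D} (hd : d ∈ S0)
    (hbase : ∀ f : Omega1 → D, Monotone f → (∀ ξ, f ξ ∈ S0) → (∀ ξ, ¬ d ≤ f ξ) →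
      ∃ η, ∀ ξ, η ≤ ξ → f ξ = f η)
    (f : Omega1 → D) (hf : Monotone f) (hdf : ∀ ξ, ¬ d ≤ f ξ) :
    ∃ η, ∀ ξ, η ≤ ξ → f ξ = f η := by
  have key : ∀ n, ∀ f : Omega1 → D, Monotone f → (∀ ξ, f ξ ∈ tw.T n) → (∀ ξ, ¬ d ≤ f ξ) →
      ∃ η, ∀ ξ, η ≤ ξ → f ξ = f η := by
    intro n
    induction n with
    | zero => rw [tw.T_zero]; exact hbase
    | succ n ih =>
      intro f hf hT hdf
      have hr : ∀ ξ, ∃ r, tw.φ n r = f ξ := fun ξ => by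
        have := hT ξ
        rwa [← tw.phi_range] at this
      choose r hr using hr
      obtain ⟨η, hη⟩ := ih (fun ξ => piIn (r ξ).1)
        (fun ξ ζ h => tw.piIn_mono (by rw [hr, hr]; exact hf h))
        (fun ξ => (r ξ).2.piIn_mem_base)
        (fun ξ h => hdf ξ (by
          rw [← hr]; exact (tw.le_phi_iff_s12 (tw.base_subset_T n hd) _).2 h))
      have hsub : ∀ ξ ζ, η ≤ ξ → ξ ≤ ζ → (r ξ).1 ⊆ (r ζ).1 := fun ξ ζ h1 h2 =>
        (r ξ).2.subset_of_rleIn ((tw.phi_le n _ _).1 (by rw [hr, hr]; exact hf h2))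
          ((hη ξ h1).trans (hη ζ (h1.trans h2)).symm) (r ζ).2
      obtain ⟨θ, hθ⟩ := Omega1.eventually_const_of_countable_range
        (f := fun ξ => (r (max η ξ)).1.ncard)
        (fun ξ ζ h => Set.ncard_le_ncard
          (hsub _ _ (le_max_left _ _) (max_le_max le_rfl h)) (r _).2.1)
        (Set.to_countable _)
      refine ⟨max η θ, fun ξ hξ => ?_⟩
      have hc := hθ ξ ((le_max_right _ _).trans hξ)
      simp only [max_eq_right ((le_max_left _ _).trans hξ)] at hc
      have heq : (r (max η θ)).1 = (r ξ).1 :=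
        Set.eq_of_subset_of_ncard_le (hsub _ _ (le_max_left _ _) hξ) hc.le (r ξ).2.1
      rw [← hr, ← hr, Subtype.ext heq]
  have hlevel : ∀ ξ, ∃ n, f ξ ∈ tw.T n := fun ξ => by
    have : f ξ ∈ ⋃ n, tw.T n := tw.union_univ ▸ Set.mem_univ _
    simpa using this
  choose l hl using hlevel
  obtain ⟨n, hn⟩ := Omega1.exists_unbounded_fiber l (Set.to_countable _)
  have hU : ∀ ξ, {ζ | ξ ≤ ζ ∧ l ζ = n}.Nonempty := hn
  let g : Omega1 → Omega1 := fun ξ => wellFounded_lt.min _ (hU ξ)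
  have hg : ∀ ξ, ξ ≤ g ξ ∧ l (g ξ) = n := fun ξ => wellFounded_lt.min_mem _ (hU ξ)
  have hgmono : Monotone g := fun ξ ζ h =>
    wellFounded_lt.min_le (s := {θ | ξ ≤ θ ∧ l θ = n}) ⟨h.trans (hg ζ).1, (hg ζ).2⟩
  obtain ⟨η, hη⟩ := key n (f ∘ g) (hf.comp hgmono)
    (fun ξ => by simpa [(hg ξ).2] using hl (g ξ)) (fun ξ => hdf _)
  refine Omega1.eventually_const_of_unbounded_fiber hf (v := f (g η)) fun ξ => ?_
  exact ⟨g (max ξ η), (le_max_left _ _).trans (hg _).1, hη _ (le_max_right _ _)⟩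

end RTower

end Tower

namespace SLamData

variable {D : Type*} [SemilatticeSup D] [OrderBot D] {Λ : Type*} [LinearOrder Λ]
  (sd : SLamData D Λ)

theorem c_mem_SX_s12 (i : Λ) : sd.c i ∈ sd.SX Set.univ :=
  subset_supClosure (Or.inr ⟨i, trivial, rfl⟩)

theorem SX_subset {y : D} (hy : y ∈ sd.SX Set.univ) :
    sd.a ⊔ sd.b ≤ y ∨ ∃ e ∈ ({⊥, sd.a, sd.b} : Set D), ∃ k ∈ insert ⊥ (Set.range sd.c),
      y = e ⊔ k := by
  refine supClosure_min (t := {y | sd.a ⊔ sd.b ≤ y ∨ ∃ e ∈ ({⊥, sd.a, sd.b} : Set D),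
    ∃ k ∈ insert ⊥ (Set.range sd.c), y = e ⊔ k}) ?_ ?_ hy
  · rintro y ((rfl | rfl | rfl | rfl) | ⟨i, -, rfl⟩)
    · exact Or.inr ⟨⊥, by simp, ⊥, by simp, by simp⟩
    · exact Or.inr ⟨sd.a, by simp, ⊥, by simp, by simp⟩
    · exact Or.inr ⟨sd.b, by simp, ⊥, by simp, by simp⟩
    · exact Or.inl le_rfl
    · exact Or.inr ⟨⊥, by simp, sd.c i, by simp, by simp⟩
  · rintro y (hy | ⟨e, he, k, hk, rfl⟩) z (hz | ⟨e', he', k', hk', rfl⟩)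
    · exact Or.inl (hy.trans le_sup_left)
    · exact Or.inl (hy.trans le_sup_left)
    · exact Or.inl (hz.trans le_sup_right)
    · have hkk : k ⊔ k' ∈ insert ⊥ (Set.range sd.c) := by
        rcases hk with rfl | ⟨i, rfl⟩
        · simpa using hk'
        · rcases hk' with rfl | ⟨j, rfl⟩
          · simp
          · exact Or.inr ⟨i ⊔ j, sd.c_mono.map_sup i j⟩
      have hee : e ⊔ e' ∈ ({⊥, sd.a, sd.b} : Set D) ∨ sd.a ⊔ sd.b ≤ e ⊔ e' := by
        rcases he with rfl | rfl | rfl <;> rcases he' with rfl | rfl | rfl <;>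
          simp [sup_comm]
      rw [sup_sup_sup_comm]
      exact hee.symm.imp (fun h => h.trans le_sup_left) fun h => ⟨_, h, _, hkk, rfl⟩

theorem le_of_c_le_sup {e : D} (he : e ∈ ({⊥, sd.a, sd.b} : Set D)) {i j : Λ}
    (h : sd.c i ≤ e ⊔ sd.c j) : i ≤ j := by
  rcases he with rfl | rfl | rfl
  · exact sd.c_le_a_sup_c i j (h.trans (sup_le_sup_right bot_le _))
  · exact sd.c_le_a_sup_c i j h
  · exact sd.c_le_b_sup_c i j h

theorem not_c_le_of_mem {e : D} (he : e ∈ ({⊥, sd.a, sd.b} : Set D)) (i : Λ) :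
    ¬ sd.c i ≤ e := by
  rcases he with rfl | rfl | rfl
  · exact fun h => sd.not_c_le_a i (h.trans bot_le)
  · exact sd.not_c_le_a i
  · exact sd.not_c_le_b i

theorem countable_SX_not_ge {i : Λ} (hi : (Set.Iio i).Countable) :
    {y ∈ sd.SX Set.univ | ¬ sd.c i ≤ y}.Countable := by
  have hE : ({⊥, sd.a, sd.b} : Set D).Countable := Set.to_countable _
  refine (hE.image2 ((hi.image sd.c).insert ⊥) (· ⊔ ·)).mono ?_
  rintro y ⟨hy, hiy⟩
  rcases sd.SX_subset hy with h | ⟨e, he, k, hk, rfl⟩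
  · exact absurd ((sd.c_le_ab i).trans h) hiy
  · refine ⟨e, he, k, ?_, rfl⟩
    rcases hk with rfl | ⟨j, rfl⟩
    · exact Or.inl rfl
    · refine Or.inr ⟨j, ?_, rfl⟩
      by_contra hj
      exact hiy ((sd.c_mono (not_lt.1 hj)).trans le_sup_right)

/-- At limit indices `i`, an element above all `c j` with `j < i` is above `c i`. -/
theorem c_le_of_forall_lt (tw : RTower D (sd.SX Set.univ)) {i : Λ} (hne : ∃ j, j < i)
    (hlim : ∀ j < i, ∃ k < i, j < k) {y : D} (hy : ∀ j < i, sd.c j ≤ y) : sd.c i ≤ y := by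
  obtain ⟨n, hn⟩ : ∃ n, y ∈ tw.T n := by
    have : y ∈ ⋃ n, tw.T n := tw.union_univ ▸ Set.mem_univ _
    simpa using this
  induction n generalizing y with
  | zero =>
    rw [tw.T_zero] at hn
    rcases sd.SX_subset hn with h | ⟨e, he, k, rfl | ⟨j, rfl⟩, rfl⟩
    · exact (sd.c_le_ab i).trans h
    · obtain ⟨j, hj⟩ := hne
      exact absurd (by simpa using hy j hj) (sd.not_c_le_of_mem he j)
    · refine (sd.c_mono ?_).trans le_sup_right
      by_contra! hji
      obtain ⟨k, hki, hjk⟩ := hlim j hji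
      exact hjk.not_ge (sd.le_of_c_le_sup he (hy k hki))
  | succ n ih =>
    rw [← tw.phi_range] at hn
    obtain ⟨r, rfl⟩ := hn
    have hc := fun j => tw.le_phi_iff_s12 (tw.base_subset_T n (sd.c_mem_SX_s12 j)) r
    exact (hc i).2 (ih (fun j hj => (hc j).1 (hy j hj)) r.2.piIn_mem_base)

end SLamData

/-- an isotone `ω₁`-sequence in `F(ω₁)` is either eventually constant, or
satisfies `c_ξ ≤ x_ξ` on a closed unbounded set of `ξ`. -/
theorem eventually_constant_or_club (D : Type*) [SemilatticeSup D] [OrderBot D]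
    (sd : SLamData D Omega1) (tw : RTower D (sd.SX Set.univ))
    (x : Omega1 → D) (hmono : Monotone x) :
    (∃ η : Omega1, ∀ ξ : Omega1, η ≤ ξ → x ξ = x η) ∨
    ∃ C : Set Omega1, ClosedUnbounded C ∧ ∀ ξ ∈ C, sd.c ξ ≤ x ξ := by
  by_cases hx : ∃ η, ∀ ξ, ¬ sd.c η ≤ x ξ
  · obtain ⟨η, hη⟩ := hx
    refine Or.inl (tw.eventually_const_of_not_le (sd.c_mem_SX_s12 η) ?_ x hmono hη)
    intro f hf hfS hfη
    refine Omega1.eventually_const_of_countable_range hf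
      ((sd.countable_SX_not_ge η.countable_Iio).mono ?_)
    rintro _ ⟨ξ, rfl⟩
    exact ⟨hfS ξ, hfη ξ⟩
  push Not at hx
  have hstep : ∀ η, ∃ ζ, η < ζ ∧ sd.c η ≤ x ζ := fun η => by
    obtain ⟨ξ, hξ⟩ := hx η
    obtain ⟨θ, hθ⟩ := η.exists_gt
    exact ⟨max θ ξ, hθ.trans_le (le_max_left _ _), hξ.trans (hmono (le_max_right _ _))⟩
  choose h hlt hle using hstep
  refine Or.inr ⟨{ξ | (∃ ζ, ζ < ξ) ∧ ∀ η < ξ, ∃ ζ < ξ, η < ζ ∧ sd.c η ≤ x ζ}, ⟨?_, ?_⟩, ?_⟩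
  · intro ξ
    let s : ℕ → Omega1 := fun n => h^[n] ξ
    have hs : ∀ n, s (n + 1) = h (s n) := fun n => Function.iterate_succ_apply' h n ξ
    obtain ⟨θ, hθ⟩ := Omega1.exists_isLUB_range s
    have hsθ : ∀ n, s n < θ := fun n =>
      (hlt (s n)).trans_le (hs n ▸ hθ.1 ⟨n + 1, rfl⟩)
    refine ⟨θ, ⟨⟨_, hsθ 0⟩, fun η hη => ?_⟩, (hsθ 0).le⟩
    obtain ⟨_, ⟨n, rfl⟩, hn⟩ := (lt_isLUB_iff hθ).1 hη
    exact ⟨s (n + 1), hsθ _, hn.trans (hs n ▸ hlt _),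
      (sd.c_mono hn.le).trans (hs n ▸ hle _)⟩
  · rintro s hs ⟨σ, hσ⟩ ξ hξ
    refine ⟨(hs hσ).1.imp fun ζ hζ => hζ.trans_le (hξ.1 hσ), fun η hη => ?_⟩
    obtain ⟨τ, hτ, hητ⟩ := (lt_isLUB_iff hξ).1 hη
    obtain ⟨ζ, hζ, hh⟩ := (hs hτ).2 η hητ
    exact ⟨ζ, hζ.trans_le (hξ.1 hτ), hh⟩
  · rintro ξ ⟨hne, hξ⟩
    refine sd.c_le_of_forall_lt tw hne (fun j hj => ?_) (fun j hj => ?_)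
    · obtain ⟨ζ, h1, h2, -⟩ := hξ j hj
      exact ⟨ζ, h1, h2⟩
    · obtain ⟨ζ, h1, -, h2⟩ := hξ j hj
      exact h2.trans (hmono h1.le)
end
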